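/- For ρ > 0, ε ∈ (0,1) and constants C₁ > 0, C₂ > 0, define λ_ε(ρ) := inf_{m ∈ [0,1]} max( (π/(ρ + C₁ρ²)) m², (C₂/ε)(1 − m)³ ) and Λ_ε(r) := ∫₀^r min(λ_ε(ρ), C₂/ε) dρ for r > 0. Then for every C₁ > 0, C₂ > 0 and R > 0 there exists a constant C₃ (depending only on C₁, C₂, R) such that for all ε ∈ (0,1) and all r with ε < r ≤ R, one has Λ_ε(r) ≥ π log(r/ε) − C₃. -/

import Mathlib

/-- The truncated minimal circle energy density `λ_ε(ρ)`. -/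
noncomputable def lambdaEps (C₁ C₂ ε ρ : ℝ) : ℝ :=
  sInf ((fun m => max ((Real.pi / (ρ + C₁ * ρ ^ 2)) * m ^ 2) ((C₂ / ε) * (1 - m) ^ 3)) ''
    Set.Icc (0 : ℝ) 1)

/-- Its primitive `Λ_ε(r)`. -/
noncomputable def LambdaEps (C₁ C₂ ε r : ℝ) : ℝ :=
  ∫ ρ in (0 : ℝ)..r, min (lambdaEps C₁ C₂ ε ρ) (C₂ / ε)

theorem mul_one_sub_two_mul_le_max {a b δ m : ℝ} (ha : 0 ≤ a) (hb : 0 ≤ b) (hδ : 0 ≤ δ)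
    (hab : a ≤ b * δ ^ 3) : a * (1 - 2 * δ) ≤ max (a * m ^ 2) (b * (1 - m) ^ 3) := by
  rcases le_total δ (1 - m) with h | h
  · refine le_max_of_le_right ?_
    calc a * (1 - 2 * δ) ≤ a := by nlinarith [mul_nonneg ha hδ]
      _ ≤ b * δ ^ 3 := hab
      _ ≤ b * (1 - m) ^ 3 := by gcongr
  · refine le_max_of_le_left (mul_le_mul_of_nonneg_left ?_ ha)
    nlinarith [sq_nonneg (1 - m)]

theorem lambdaEps_bddBelow {b : ℝ} (hb : 0 ≤ b) (a : ℝ) :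
    BddBelow ((fun m => max (a * m ^ 2) (b * (1 - m) ^ 3)) '' Set.Icc (0 : ℝ) 1) := by
  refine ⟨0, ?_⟩
  rintro _ ⟨m, hm, rfl⟩
  exact le_max_of_le_right (mul_nonneg hb (pow_nonneg (sub_nonneg.2 hm.2) 3))

theorem le_lambdaEps {C₁ C₂ ε ρ x : ℝ}
    (h : ∀ m ∈ Set.Icc (0 : ℝ) 1,
      x ≤ max ((Real.pi / (ρ + C₁ * ρ ^ 2)) * m ^ 2) ((C₂ / ε) * (1 - m) ^ 3)) :
    x ≤ lambdaEps C₁ C₂ ε ρ := by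
  refine le_csInf ((Set.nonempty_Icc.2 zero_le_one).image _) ?_
  rintro _ ⟨m, hm, rfl⟩
  exact h m hm

theorem lambdaEps_le {C₁ C₂ ε ρ m : ℝ} (hb : 0 ≤ C₂ / ε) (hm : m ∈ Set.Icc (0 : ℝ) 1) :
    lambdaEps C₁ C₂ ε ρ ≤
      max ((Real.pi / (ρ + C₁ * ρ ^ 2)) * m ^ 2) ((C₂ / ε) * (1 - m) ^ 3) :=
  csInf_le (lambdaEps_bddBelow hb _) (Set.mem_image_of_mem _ hm)

theorem lambdaEps_nonneg {C₁ C₂ ε ρ : ℝ} (hb : 0 ≤ C₂ / ε) : 0 ≤ lambdaEps C₁ C₂ ε ρ :=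
  le_lambdaEps fun _ hm =>
    le_max_of_le_right (mul_nonneg hb (pow_nonneg (sub_nonneg.2 hm.2) 3))

theorem lambdaEps_le_div {C₁ C₂ ε ρ : ℝ} (hb : 0 ≤ C₂ / ε) :
    lambdaEps C₁ C₂ ε ρ ≤ C₂ / ε := by
  simpa [hb] using lambdaEps_le (C₁ := C₁) (ρ := ρ) hb (Set.left_mem_Icc.2 zero_le_one)

theorem lambdaEps_antitoneOn {C₁ C₂ ε : ℝ} (hC₁ : 0 ≤ C₁) (hb : 0 ≤ C₂ / ε) :
    AntitoneOn (lambdaEps C₁ C₂ ε) (Set.Ioi 0) := by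
  intro x hx y _ hxy
  have hx : 0 < x := hx
  refine le_lambdaEps fun m hm => (lambdaEps_le hb hm).trans ?_
  gcongr

theorem intervalIntegrable_lambdaEps {C₁ C₂ ε r : ℝ} (hC₁ : 0 ≤ C₁) (hb : 0 ≤ C₂ / ε)
    (hr : 0 ≤ r) : IntervalIntegrable (lambdaEps C₁ C₂ ε) MeasureTheory.volume 0 r := by
  rw [intervalIntegrable_iff_integrableOn_Ioc_of_le hr]
  refine MeasureTheory.IntegrableOn.of_bound (by simp) ?_ (C₂ / ε) ?_
  · exact (aemeasurable_restrict_of_antitoneOn measurableSet_Ioc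
      ((lambdaEps_antitoneOn hC₁ hb).mono fun _ hx => hx.1)).aestronglyMeasurable
  · refine Filter.Eventually.of_forall fun ρ => ?_
    rw [Real.norm_of_nonneg (lambdaEps_nonneg hb)]
    exact lambdaEps_le_div hb

theorem LambdaEps_eq_integral {C₁ C₂ ε : ℝ} (hb : 0 ≤ C₂ / ε) (r : ℝ) :
    LambdaEps C₁ C₂ ε r = ∫ ρ in (0 : ℝ)..r, lambdaEps C₁ C₂ ε ρ := by
  simp only [LambdaEps, min_eq_left (lambdaEps_le_div hb)]

theorem lambdaEps_lower_bound {C₁ C₂ ε ρ c : ℝ} (hC₁ : 0 ≤ C₁) (hC₂ : 0 < C₂) (hε : 0 < ε)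
    (hρ : 0 < ρ) (hc : 0 ≤ c) (hcC : Real.pi ≤ C₂ * c ^ 3) :
    Real.pi * ρ⁻¹ - Real.pi * C₁ -
      2 * Real.pi * c * ε ^ (1 / 3 : ℝ) * ρ ^ (-1 / 3 - 1 : ℝ) ≤ lambdaEps C₁ C₂ ε ρ := by
  have hπ := Real.pi_pos
  set δ := c * ε ^ (1 / 3 : ℝ) * ρ ^ (-1 / 3 : ℝ) with hδ
  have hδ0 : 0 ≤ δ := by positivity
  have hε3 : (ε ^ (1 / 3 : ℝ)) ^ 3 = ε := by
    rw [← Real.rpow_natCast, ← Real.rpow_mul hε.le]; norm_num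
  have hρ3 : (ρ ^ (-1 / 3 : ℝ)) ^ 3 = ρ⁻¹ := by
    rw [← Real.rpow_natCast, ← Real.rpow_mul hρ.le, ← Real.rpow_neg_one]; norm_num
  have hδ3 : C₂ / ε * δ ^ 3 = C₂ * c ^ 3 * ρ⁻¹ := by
    rw [hδ, mul_pow, mul_pow, hε3, hρ3]; field_simp
  set a := Real.pi / (ρ + C₁ * ρ ^ 2) with ha
  have ha0 : 0 ≤ a := by positivity
  have ha1 : a ≤ Real.pi * ρ⁻¹ := by
    rw [ha, ← div_eq_mul_inv]; gcongr; nlinarith [mul_nonneg hC₁ (sq_nonneg ρ)]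
  have ha2 : Real.pi * ρ⁻¹ - Real.pi * C₁ ≤ a := by
    have : Real.pi * ρ⁻¹ - Real.pi * C₁ = Real.pi * (1 - C₁ * ρ) / ρ := by field_simp
    rw [this, ha, div_le_div_iff₀ hρ (by positivity)]
    have : 0 ≤ Real.pi * (C₁ ^ 2 * ρ ^ 3) := by positivity
    nlinarith
  have hab : a ≤ C₂ / ε * δ ^ 3 := by
    rw [hδ3]; exact ha1.trans (by gcongr)
  refine le_trans ?_ (le_lambdaEps fun m _ =>
    mul_one_sub_two_mul_le_max ha0 (by positivity) hδ0 hab)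
  have hpow : 2 * Real.pi * c * ε ^ (1 / 3 : ℝ) * ρ ^ (-1 / 3 - 1 : ℝ) =
      2 * (Real.pi * ρ⁻¹ * δ) := by
    rw [Real.rpow_sub_one hρ.ne', hδ]; ring
  rw [hpow]
  nlinarith [mul_le_mul_of_nonneg_right ha1 hδ0]

/-- Logarithmic lower bound for `Λ_ε`: for every `C₁, C₂, R > 0` there is a constant `C₃`
such that `Λ_ε(r) ≥ π log(r/ε) − C₃` for all `ε ∈ (0,1)` and `ε < r ≤ R`. -/
theorem LambdaEps_log_lower_bound (C₁ C₂ R : ℝ) (hC₁ : 0 < C₁) (hC₂ : 0 < C₂) (hR : 0 < R) :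
    ∃ C₃ : ℝ, ∀ ε : ℝ, 0 < ε → ε < 1 → ∀ r : ℝ, ε < r → r ≤ R →
      Real.pi * Real.log (r / ε) - C₃ ≤ LambdaEps C₁ C₂ ε r := by
  have hπ := Real.pi_pos
  obtain ⟨c, hc, hcC⟩ : ∃ c : ℝ, 0 ≤ c ∧ Real.pi ≤ C₂ * c ^ 3 := by
    refine ⟨1 + Real.pi / C₂, by positivity, ?_⟩
    calc Real.pi ≤ C₂ * (1 + Real.pi / C₂) := by field_simp; linarith
      _ ≤ C₂ * (1 + Real.pi / C₂) ^ 3 := by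
        gcongr
        exact le_self_pow₀ (le_add_of_nonneg_right (by positivity)) (by norm_num)
  refine ⟨Real.pi * C₁ * R + 6 * Real.pi * c, fun ε hε _ r hεr hrR => ?_⟩
  have hr : 0 < r := hε.trans hεr
  have hb : 0 ≤ C₂ / ε := by positivity
  have hpos : ∀ x ∈ Set.uIcc ε r, 0 < x := fun x hx => by
    rw [Set.uIcc_of_le hεr.le] at hx; exact hε.trans_le hx.1
  have hint := intervalIntegrable_lambdaEps (C₁ := C₁) hC₁.le hb hr.le
  set g : ℝ → ℝ := fun ρ => Real.pi * ρ⁻¹ - Real.pi * C₁ -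
      2 * Real.pi * c * ε ^ (1 / 3 : ℝ) * ρ ^ (-1 / 3 - 1 : ℝ) with hg
  have hgint : IntervalIntegrable g MeasureTheory.volume ε r := by
    refine ContinuousOn.intervalIntegrable fun x hx => ContinuousAt.continuousWithinAt ?_
    have hx0 := (hpos x hx).ne'
    exact (((continuousAt_inv₀ hx0).const_mul _).sub continuousAt_const).sub
      ((Real.continuousAt_rpow_const _ _ (Or.inl hx0)).const_mul _)
  have hFTC := intervalIntegral.integral_eq_sub_of_hasDerivAt (f' := g)
    (f := fun ρ => Real.pi * Real.log ρ - Real.pi * C₁ * ρ +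
      6 * Real.pi * c * ε ^ (1 / 3 : ℝ) * ρ ^ (-1 / 3 : ℝ)) (fun x hx => by
      have hx0 := (hpos x hx).ne'
      have := (((Real.hasDerivAt_log hx0).const_mul Real.pi).sub
        ((hasDerivAt_id x).const_mul (Real.pi * C₁))).add
        ((Real.hasDerivAt_rpow_const (p := (-1 / 3 : ℝ)) (Or.inl hx0)).const_mul
          (6 * Real.pi * c * ε ^ (1 / 3 : ℝ)))
      exact this.congr_deriv (by simp only [hg]; ring)) hgint
  have hεε : ε ^ (1 / 3 : ℝ) * ε ^ (-1 / 3 : ℝ) = 1 := by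
    rw [← Real.rpow_add hε]; norm_num
  have hrest : 0 ≤ 6 * Real.pi * c * ε ^ (1 / 3 : ℝ) * r ^ (-1 / 3 : ℝ) := by positivity
  have hRr : Real.pi * C₁ * r ≤ Real.pi * C₁ * R := by gcongr
  have hεC : 0 ≤ Real.pi * C₁ * ε := by positivity
  calc Real.pi * Real.log (r / ε) - (Real.pi * C₁ * R + 6 * Real.pi * c)
      ≤ ∫ ρ in ε..r, g ρ := by
        rw [hFTC, Real.log_div hr.ne' hε.ne', mul_assoc (6 * Real.pi * c) _ (ε ^ (-1 / 3 : ℝ)), hεε]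
        linarith
    _ ≤ ∫ ρ in ε..r, lambdaEps C₁ C₂ ε ρ :=
        intervalIntegral.integral_mono_on hεr.le hgint
          (hint.mono_set (by
            rw [Set.uIcc_of_le hεr.le, Set.uIcc_of_le hr.le]
            exact Set.Icc_subset_Icc_left hε.le))
          fun ρ hρ => lambdaEps_lower_bound hC₁.le hC₂ hε (hε.trans_le hρ.1) hc hcC
    _ ≤ ∫ ρ in (0 : ℝ)..r, lambdaEps C₁ C₂ ε ρ :=
        intervalIntegral.integral_mono_interval hε.le hεr.le le_rfl
          (Filter.Eventually.of_forall fun _ => lambdaEps_nonneg hb) hint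
    _ = LambdaEps C₁ C₂ ε r := (LambdaEps_eq_integral hb r).symm
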